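/- arXiv:1603.07043 — 3 statements merged into one kernel-verified Lean document; each statement's English description precedes it below -/
import Mathlib

section
/- Let ρ, σ be density matrices on a finite-dimensional Hilbert space and t ∈ (0,1). If for every k, Σ_{j=1}^k λ_j(ρ ⋆_t σ) = Σ_{j=1}^k (t·λ_j(ρ) + (1−t)·λ_j(σ)), then there exists an orthonormal basis (φ_j) with ρφ_j = λ_j(ρ)·φ_j and σφ_j = λ_j(σ)·φ_j for every j. -/
open Matrix ComplexOrder

/-- Eigenvalues of a Hermitian matrix listed in non-increasing order:
`eigDesc hA j` is the `j`-th largest eigenvalue of `A`. -/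
noncomputable def eigDesc {n : ℕ} {A : Matrix (Fin n) (Fin n) ℂ} (hA : A.IsHermitian) :
    Fin n → ℝ :=
  fun j => hA.eigenvalues (Tuple.sort hA.eigenvalues (Fin.rev j))

/-- The partial-swap convolution `A ⋆_t B = tA + (1-t)B + i√(t(1-t))[A,B]`. -/
noncomputable def pswap {n : ℕ} (t : ℝ) (A B : Matrix (Fin n) (Fin n) ℂ) :
    Matrix (Fin n) (Fin n) ℂ :=
  (t : ℂ) • A + ((1 - t : ℝ) : ℂ) • B
    + (Complex.I * (Real.sqrt (t * (1 - t)) : ℂ)) • (A * B - B * A)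

section aux
open scoped InnerProductSpace
variable {E : Type*} [NormedAddCommGroup E] [InnerProductSpace ℂ E] {n : ℕ}

lemma aux_quad (e : OrthonormalBasis (Fin n) ℂ E) (R : E →ₗ[ℂ] E) (hR : R.IsSymmetric)
    (l : Fin n → ℝ) (he : ∀ i, R (e i) = (l i : ℂ) • e i) (a : ℝ) (x : E) :
    (⟪x, R x⟫_ℂ).re - a * ‖x‖ ^ 2 = ∑ i, (l i - a) * ‖⟪e i, x⟫_ℂ‖ ^ 2 := by
  have h1 : ⟪x, R x⟫_ℂ = ∑ i, ((l i * ‖⟪e i, x⟫_ℂ‖ ^ 2 : ℝ) : ℂ) := by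
    rw [← e.sum_inner_mul_inner]
    refine Finset.sum_congr rfl fun i _ => ?_
    rw [← hR, he, inner_smul_left, ← inner_conj_symm x (e i)]
    have := Complex.conj_mul' (⟪e i, x⟫_ℂ)
    push_cast
    rw [← this]
    simp
    ring
  have h2 := e.sum_sq_norm_inner_right x
  rw [h1, ← h2, ← Complex.ofReal_sum, Complex.ofReal_re, Finset.mul_sum, ← Finset.sum_sub_distrib]
  exact Finset.sum_congr rfl fun i _ => by ring

lemma aux_bessel (g : OrthonormalBasis (Fin n) ℂ E) (s : Finset (Fin n)) (v : E)
    (hv : ∀ i ∈ s, ⟪g i, v⟫_ℂ = 0) (x : E) :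
    (∑ i ∈ s, ‖⟪x, g i⟫_ℂ‖ ^ 2) * ‖v‖ ^ 2 + ‖⟪x, v⟫_ℂ‖ ^ 2 ≤ ‖x‖ ^ 2 * ‖v‖ ^ 2 := by
  have h1 : ⟪x, v⟫_ℂ = ∑ i ∈ sᶜ, ⟪x, g i⟫_ℂ * ⟪g i, v⟫_ℂ := by
    rw [← g.sum_inner_mul_inner x v, ← Finset.sum_add_sum_compl s]
    rw [Finset.sum_eq_zero, zero_add]
    intro i hi; rw [hv i hi, mul_zero]
  have h2 : ‖x‖ ^ 2 = ∑ i ∈ s, ‖⟪x, g i⟫_ℂ‖ ^ 2 + ∑ i ∈ sᶜ, ‖⟪x, g i⟫_ℂ‖ ^ 2 := by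
    rw [Finset.sum_add_sum_compl, g.sum_sq_norm_inner_left]
  have h3 : ∑ i ∈ sᶜ, ‖⟪g i, v⟫_ℂ‖ ^ 2 ≤ ‖v‖ ^ 2 := by
    rw [← g.sum_sq_norm_inner_right v]
    exact Finset.sum_le_sum_of_subset_of_nonneg (Finset.subset_univ _) (fun _ _ _ => by positivity)
  have h4 : ‖⟪x, v⟫_ℂ‖ ^ 2 ≤ (∑ i ∈ sᶜ, ‖⟪x, g i⟫_ℂ‖ ^ 2) * ∑ i ∈ sᶜ, ‖⟪g i, v⟫_ℂ‖ ^ 2 := by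
    refine le_trans ?_ (Finset.sum_mul_sq_le_sq_mul_sq _ _ _)
    rw [h1]
    gcongr
    refine (norm_sum_le _ _).trans (le_of_eq ?_)
    simp
  have h5 : 0 ≤ ∑ i ∈ sᶜ, ‖⟪x, g i⟫_ℂ‖ ^ 2 := Finset.sum_nonneg fun _ _ => by positivity
  rw [h2]
  nlinarith [mul_le_mul_of_nonneg_left h3 h5]

lemma aux_kyfan (e g : OrthonormalBasis (Fin n) ℂ E) (R : E →ₗ[ℂ] E) (hR : R.IsSymmetric)
    (l : Fin n → ℝ) (hl : Antitone l) (he : ∀ i, R (e i) = (l i : ℂ) • e i) (j : Fin n)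
    (hg : ∀ i < j, R (g i) = (l i : ℂ) • g i) (v : E) (hv : ∀ i < j, ⟪g i, v⟫_ℂ = 0) :
    (⟪v, R v⟫_ℂ).re ≤ l j * ‖v‖ ^ 2 := by
  have hgi : ∀ i < j, l i - l j = ∑ k, (l k - l j) * ‖⟪e k, g i⟫_ℂ‖ ^ 2 := by
    intro i hi
    rw [← aux_quad e R hR l he, hg i hi, inner_smul_right]
    simp
  have hb := fun k => aux_bessel g (Finset.univ.filter (· < j)) v (by simpa using hv) (e k)
  have hq := aux_quad e R hR l he (l j) v
  have key : ∑ k, (l k - l j) * ((∑ i ∈ Finset.univ.filter (· < j), ‖⟪e k, g i⟫_ℂ‖ ^ 2) * ‖v‖ ^ 2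
      + ‖⟪e k, v⟫_ℂ‖ ^ 2) ≤ ∑ k ∈ Finset.univ.filter (· < j), (l k - l j) * ‖v‖ ^ 2 := by
    rw [Finset.sum_filter]
    refine Finset.sum_le_sum fun k _ => ?_
    split_ifs with h
    · have := hb k
      rw [e.norm_eq_one, one_pow, one_mul] at this
      exact mul_le_mul_of_nonneg_left this (sub_nonneg.2 (hl h.le))
    · exact mul_nonpos_of_nonpos_of_nonneg (sub_nonpos.2 (hl (not_lt.1 h))) (by positivity)
  have h2 : ∑ k ∈ Finset.univ.filter (· < j), (l k - l j) * ‖v‖ ^ 2 =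
     ∑ k, (l k - l j) * ((∑ i ∈ Finset.univ.filter (· < j), ‖⟪e k, g i⟫_ℂ‖ ^ 2) * ‖v‖ ^ 2) := by
    rw [Finset.sum_congr rfl (fun i hi => by rw [hgi i (by simpa using hi)])]
    simp_rw [Finset.sum_mul, Finset.mul_sum]
    rw [Finset.sum_comm]
    exact Finset.sum_congr rfl fun _ _ => Finset.sum_congr rfl fun _ _ => by ring
  simp_rw [mul_add, Finset.sum_add_distrib] at key
  linarith

/-- On the complement of the first `j` vectors, `A = l j - R` satisfies `A² ≤ A`. -/
lemma aux_sq (e g : OrthonormalBasis (Fin n) ℂ E) (R : E →ₗ[ℂ] E) (hR : R.IsSymmetric)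
    (l : Fin n → ℝ) (hl : Antitone l) (hl0 : ∀ i, 0 ≤ l i) (hl1 : ∀ i, l i ≤ 1)
    (he : ∀ i, R (e i) = (l i : ℂ) • e i) (j : Fin n)
    (hg : ∀ i < j, R (g i) = (l i : ℂ) • g i) (v : E) (hv : ∀ i < j, ⟪g i, v⟫_ℂ = 0) :
    ‖(l j : ℂ) • v - R v‖ ^ 2 ≤ (⟪v, (l j : ℂ) • v - R v⟫_ℂ).re := by
  set A : E →ₗ[ℂ] E := (l j : ℂ) • LinearMap.id - R with hA
  have hAv : ∀ x, (l j : ℂ) • x - R x = A x := fun x => by simp [hA]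
  have hAs : ∀ x y, ⟪A x, y⟫_ℂ = ⟪x, A y⟫_ℂ := by
    intro x y
    simp only [← hAv, inner_sub_left, inner_sub_right, inner_smul_left, inner_smul_right, hR x y]
    simp
  have hq : ∀ x, (⟪x, A x⟫_ℂ).re = l j * ‖x‖ ^ 2 - (⟪x, R x⟫_ℂ).re := by
    intro x
    rw [← hAv, inner_sub_right, inner_smul_right, inner_self_eq_norm_sq_to_K]
    simp [← Complex.ofReal_pow]
  rw [hAv]
  have hAW : ∀ i < j, ⟪g i, A v⟫_ℂ = 0 := by
    intro i hi
    rw [← hAs, ← hAv, hg i hi, ← sub_smul, inner_smul_left, hv i hi, mul_zero]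
  have h1 : 0 ≤ (⟪v - A v, A (v - A v)⟫_ℂ).re := by
    rw [hq, sub_nonneg]
    refine aux_kyfan e g R hR l hl he j hg _ fun i hi => ?_
    rw [inner_sub_right, hv i hi, hAW i hi, sub_zero]
  have h2 : (⟪A v, A (A v)⟫_ℂ).re ≤ ‖A v‖ ^ 2 := by
    rw [hq]
    have h3 := aux_quad e R hR l he 0 (A v)
    have h4 : 0 ≤ ∑ i, (l i - 0) * ‖⟪e i, A v⟫_ℂ‖ ^ 2 :=
      Finset.sum_nonneg fun i _ => mul_nonneg (by simpa using hl0 i) (by positivity)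
    nlinarith [mul_le_mul_of_nonneg_right (hl1 j) (sq_nonneg ‖A v‖)]
  have h5 : ⟪v, A (A v)⟫_ℂ = ((‖A v‖ ^ 2 : ℝ) : ℂ) := by
    rw [← hAs, inner_self_eq_norm_sq_to_K]; simp
  have h6 : ⟪A v, A v⟫_ℂ = ((‖A v‖ ^ 2 : ℝ) : ℂ) := by
    rw [inner_self_eq_norm_sq_to_K]; simp
  simp only [map_sub, inner_sub_left, inner_sub_right, h5, h6, Complex.sub_re,
    Complex.ofReal_re] at h1
  linarith

lemma aux_step (t : ℝ) (ht : t ∈ Set.Ioo (0 : ℝ) 1) (R S : E →ₗ[ℂ] E) (hR : R.IsSymmetric)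
    (hS : S.IsSymmetric) (v : E) (hv : ‖v‖ = 1) (a b : ℝ)
    (hC : (t : ℂ) • R v + ((1 - t : ℝ) : ℂ) • S v +
      (Complex.I * (Real.sqrt (t * (1 - t)) : ℂ)) • (R (S v) - S (R v))
        = ((t * a + (1 - t) * b : ℝ) : ℂ) • v)
    (ha : ‖(a : ℂ) • v - R v‖ ^ 2 ≤ (⟪v, (a : ℂ) • v - R v⟫_ℂ).re)
    (hb : ‖(b : ℂ) • v - S v‖ ^ 2 ≤ (⟪v, (b : ℂ) • v - S v⟫_ℂ).re) :
    R v = (a : ℂ) • v ∧ S v = (b : ℂ) • v := by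
  obtain ⟨ht0, ht1⟩ := ht
  have ht1' : 0 < 1 - t := by linarith
  set x := (a : ℂ) • v - R v with hx
  set y := (b : ℂ) • v - S v with hy
  set c := Real.sqrt t
  set s := Real.sqrt (1 - t)
  have hc : c ^ 2 = t := Real.sq_sqrt ht0.le
  have hs : s ^ 2 = 1 - t := Real.sq_sqrt ht1'.le
  have hcpos : 0 < c := Real.sqrt_pos.2 ht0
  have hspos : 0 < s := Real.sqrt_pos.2 ht1'
  have hcs : Real.sqrt (t * (1 - t)) = c * s := Real.sqrt_mul ht0.le _
  have hRv : R v = (a : ℂ) • v - x := by rw [hx]; abel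
  have hSv : S v = (b : ℂ) • v - y := by rw [hy]; abel
  have hvv : ⟪v, v⟫_ℂ = 1 := by rw [inner_self_eq_norm_sq_to_K, hv]; simp
  -- inner products are real
  have hxr : ⟪x, v⟫_ℂ = ⟪v, x⟫_ℂ := by
    simp only [hx, inner_sub_left, inner_sub_right, inner_smul_left, inner_smul_right, hR v v]
    simp
  have hyr : ⟪y, v⟫_ℂ = ⟪v, y⟫_ℂ := by
    simp only [hy, inner_sub_left, inner_sub_right, inner_smul_left, inner_smul_right, hS v v]
    simp
  have hxim : (⟪v, x⟫_ℂ).im = 0 := by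
    have := congrArg Complex.im (inner_conj_symm v x)
    rw [hxr, Complex.conj_im] at this
    linarith
  have hyim : (⟪v, y⟫_ℂ).im = 0 := by
    have := congrArg Complex.im (inner_conj_symm v y)
    rw [hyr, Complex.conj_im] at this
    linarith
  -- take the inner product with v
  have h1 := congrArg (fun z => ⟪v, z⟫_ℂ) hC
  simp only [inner_add_right, inner_sub_right, inner_smul_right, ← hR v, ← hS v, hvv] at h1
  rw [hR v v, hS v v] at h1
  simp only [hRv, hSv, inner_sub_right, inner_sub_left, inner_smul_left,
    inner_smul_right, hvv, hxr, hyr] at h1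
  rw [hcs] at h1
  have h2 : t * (⟪v, x⟫_ℂ).re + (1 - t) * (⟪v, y⟫_ℂ).re
      + c * s * ((⟪x, y⟫_ℂ).im - (⟪y, x⟫_ℂ).im) = 0 := by
    have := congrArg Complex.re h1
    simp [hxim, hyim] at this
    linarith
  have h3 : (⟪y, x⟫_ℂ).im = - (⟪x, y⟫_ℂ).im := by
    rw [← inner_conj_symm y x, Complex.conj_im]
  have h4 : ‖(c : ℂ) • x - (Complex.I * s) • y‖ ^ 2
      = t * ‖x‖ ^ 2 + (1 - t) * ‖y‖ ^ 2 + 2 * (c * s) * (⟪x, y⟫_ℂ).im := by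
    rw [@norm_sub_sq ℂ, norm_smul, norm_smul, inner_smul_left, inner_smul_right]
    simp [mul_pow, hc, hs]
    ring
  have h5 : ‖(c : ℂ) • x - (Complex.I * s) • y‖ ^ 2 ≤ 0 := by
    rw [h4]
    rw [h3] at h2
    nlinarith [mul_le_mul_of_nonneg_left ha ht0.le, mul_le_mul_of_nonneg_left hb ht1'.le]
  have h6 : (c : ℂ) • x - (Complex.I * s) • y = 0 := by
    rw [← norm_eq_zero]
    exact pow_eq_zero_iff (two_ne_zero) |>.1 (le_antisymm h5 (by positivity))
  have h7 := congrArg (fun z => ⟪v, z⟫_ℂ) h6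
  simp only [inner_sub_right, inner_smul_right, inner_zero_right] at h7
  have h8 := congrArg Complex.re h7
  have h9 := congrArg Complex.im h7
  simp [hxim, hyim, hcpos.ne', hspos.ne'] at h8 h9
  have hx0 : x = 0 := by
    rw [h8] at ha
    exact norm_eq_zero.1 (pow_eq_zero_iff (two_ne_zero) |>.1 (le_antisymm ha (by positivity)))
  have hy0 : y = 0 := by
    rw [h9] at hb
    exact norm_eq_zero.1 (pow_eq_zero_iff (two_ne_zero) |>.1 (le_antisymm hb (by positivity)))
  exact ⟨by rw [hRv, hx0, sub_zero], by rw [hSv, hy0, sub_zero]⟩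

lemma aux_main (t : ℝ) (ht : t ∈ Set.Ioo (0 : ℝ) 1) (R S : E →ₗ[ℂ] E) (hR : R.IsSymmetric)
    (hS : S.IsSymmetric) (e f g : OrthonormalBasis (Fin n) ℂ E) (l m : Fin n → ℝ)
    (hl : Antitone l) (hl0 : ∀ i, 0 ≤ l i) (hl1 : ∀ i, l i ≤ 1)
    (hm : Antitone m) (hm0 : ∀ i, 0 ≤ m i) (hm1 : ∀ i, m i ≤ 1)
    (he : ∀ i, R (e i) = (l i : ℂ) • e i) (hf : ∀ i, S (f i) = (m i : ℂ) • f i)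
    (hC : ∀ i, (t : ℂ) • R (g i) + ((1 - t : ℝ) : ℂ) • S (g i) +
      (Complex.I * (Real.sqrt (t * (1 - t)) : ℂ)) • (R (S (g i)) - S (R (g i)))
        = ((t * l i + (1 - t) * m i : ℝ) : ℂ) • g i) (j : Fin n) :
    R (g j) = (l j : ℂ) • g j ∧ S (g j) = (m j : ℂ) • g j := by
  induction j using WellFoundedLT.induction with
  | ind j ih =>
    have ho : ∀ i < j, ⟪g i, g j⟫_ℂ = 0 := fun i hi => g.orthonormal.2 hi.ne
    exact aux_step t ht R S hR hS (g j) (g.norm_eq_one j) _ _ (hC j)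
      (aux_sq e g R hR l hl hl0 hl1 he j (fun i hi => (ih i hi).1) _ ho)
      (aux_sq f g S hS m hm hm0 hm1 hf j (fun i hi => (ih i hi).2) _ ho)

end aux

lemma eigDesc_antitone {n : ℕ} {A : Matrix (Fin n) (Fin n) ℂ} (hA : A.IsHermitian) :
    Antitone (eigDesc hA) := fun _ _ h =>
  Tuple.monotone_sort hA.eigenvalues (Fin.rev_le_rev.2 h)

/-- Ordered eigenbasis. -/
noncomputable def descBasis {n : ℕ} {A : Matrix (Fin n) (Fin n) ℂ} (hA : A.IsHermitian) :
    OrthonormalBasis (Fin n) ℂ (EuclideanSpace ℂ (Fin n)) :=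
  hA.eigenvectorBasis.reindex (Fin.revPerm.trans (Tuple.sort hA.eigenvalues)).symm

lemma descBasis_mulVec {n : ℕ} {A : Matrix (Fin n) (Fin n) ℂ} (hA : A.IsHermitian) (j : Fin n) :
    A *ᵥ (descBasis hA j).ofLp = (eigDesc hA j : ℂ) • (descBasis hA j).ofLp := by
  have := hA.mulVec_eigenvectorBasis (Tuple.sort hA.eigenvalues (Fin.rev j))
  simpa [descBasis, eigDesc] using this

lemma descBasis_lin {n : ℕ} {A : Matrix (Fin n) (Fin n) ℂ} (hA : A.IsHermitian) (j : Fin n) :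
    Matrix.toEuclideanLin A (descBasis hA j) = (eigDesc hA j : ℂ) • descBasis hA j := by
  apply (WithLp.ofLp_injective 2)
  simpa using descBasis_mulVec hA j

lemma eigDesc_nonneg {n : ℕ} {A : Matrix (Fin n) (Fin n) ℂ} (hA : A.PosSemidef) (j : Fin n) :
    0 ≤ eigDesc hA.isHermitian j := hA.eigenvalues_nonneg _

lemma eigDesc_le_one {n : ℕ} {A : Matrix (Fin n) (Fin n) ℂ} (hA : A.PosSemidef)
    (h1 : A.trace = 1) (j : Fin n) : eigDesc hA.isHermitian j ≤ 1 := by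
  have h := hA.isHermitian.trace_eq_sum_eigenvalues
  rw [h1] at h
  have h' : (1 : ℝ) = ∑ i, hA.isHermitian.eigenvalues i := by simpa using congrArg Complex.re h
  rw [h']
  exact Finset.single_le_sum (fun i _ => hA.eigenvalues_nonneg i) (Finset.mem_univ _)

theorem stmt_10 {n : ℕ} (t : ℝ) (ht : t ∈ Set.Ioo (0 : ℝ) 1)
    (ρ σ : Matrix (Fin n) (Fin n) ℂ)
    (hρ : ρ.PosSemidef) (hσ : σ.PosSemidef)
    (hρ1 : ρ.trace = 1) (hσ1 : σ.trace = 1)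
    (hC : (pswap t ρ σ).IsHermitian)
    (heq : ∀ k : ℕ,
      ∑ j ∈ Finset.univ.filter (fun j : Fin n => (j : ℕ) < k), eigDesc hC j
        = ∑ j ∈ Finset.univ.filter (fun j : Fin n => (j : ℕ) < k),
            (t * eigDesc hρ.isHermitian j + (1 - t) * eigDesc hσ.isHermitian j)) :
    ∃ φ : Fin n → (Fin n → ℂ),
      (∀ i j, star (φ i) ⬝ᵥ φ j = if i = j then (1 : ℂ) else 0) ∧
      (∀ j, ρ *ᵥ φ j = (eigDesc hρ.isHermitian j : ℂ) • φ j) ∧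
      (∀ j, σ *ᵥ φ j = (eigDesc hσ.isHermitian j : ℂ) • φ j) := by
  have hj : ∀ j, eigDesc hC j
      = t * eigDesc hρ.isHermitian j + (1 - t) * eigDesc hσ.isHermitian j := by
    intro j
    have hf : Finset.univ.filter (fun i : Fin n => (i : ℕ) < (j : ℕ) + 1)
        = insert j (Finset.univ.filter (fun i : Fin n => (i : ℕ) < (j : ℕ))) := by
      ext i
      simp [Fin.ext_iff]
      omega
    have h1 := heq (j + 1)
    rw [hf, Finset.sum_insert (by simp), Finset.sum_insert (by simp), heq j] at h1
    exact add_right_cancel h1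
  have hmain := aux_main t ht (Matrix.toEuclideanLin ρ) (Matrix.toEuclideanLin σ)
    (Matrix.isSymmetric_toEuclideanLin_iff.2 hρ.isHermitian)
    (Matrix.isSymmetric_toEuclideanLin_iff.2 hσ.isHermitian)
    (descBasis hρ.isHermitian) (descBasis hσ.isHermitian) (descBasis hC)
    _ _ (eigDesc_antitone _) (eigDesc_nonneg hρ) (eigDesc_le_one hρ hρ1)
    (eigDesc_antitone _) (eigDesc_nonneg hσ) (eigDesc_le_one hσ hσ1)
    (descBasis_lin _) (descBasis_lin _) (by
      intro i
      rw [← hj, ← descBasis_lin hC]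
      apply (WithLp.ofLp_injective 2)
      simp [pswap, Matrix.smul_mulVec, Matrix.mulVec_mulVec])
  refine ⟨fun j => (descBasis hC j).ofLp, ?_, ?_, ?_⟩
  · intro i j
    have := orthonormal_iff_ite.1 (descBasis hC).orthonormal i j
    rw [← this, EuclideanSpace.inner_eq_star_dotProduct, dotProduct_comm]
  · intro j
    simpa using congrArg WithLp.ofLp (hmain j).1
  · intro j
    simpa using congrArg WithLp.ofLp (hmain j).2
end

section
/- For density matrices ρ, σ on a finite-dimensional Hilbert space and t ∈ [0,1], the von Neumann entropy satisfies S(ρ ⋆_t σ) ≥ t·S(ρ) + (1−t)·S(σ), where ρ ⋆_t σ = t·ρ + (1−t)·σ + i·√(t(1−t))·[ρ,σ]. -/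
open Matrix ComplexOrder

/-- The von Neumann entropy `S(A) = -Tr[A log A] = Σⱼ -λⱼ log λⱼ`. -/
noncomputable def vnEntropy {n : ℕ} {A : Matrix (Fin n) (Fin n) ℂ} (hA : A.IsHermitian) : ℝ :=
  ∑ j, Real.negMulLog (hA.eigenvalues j)

/-- Functional calculus through the spectral decomposition. -/
noncomputable def specFun {n : ℕ} {A : Matrix (Fin n) (Fin n) ℂ} (hA : A.IsHermitian)
    (f : ℝ → ℝ) : Matrix (Fin n) (Fin n) ℂ :=
  Unitary.conjStarAlgAut ℂ _ hA.eigenvectorUnitary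
    (Matrix.diagonal (fun i => ((f (hA.eigenvalues i) : ℝ) : ℂ)))

section spec
variable {n : ℕ} {A : Matrix (Fin n) (Fin n) ℂ} (hA : A.IsHermitian)

theorem specFun_id : specFun hA (fun x => x) = A := hA.spectral_theorem.symm

theorem specFun_const (c : ℝ) : specFun hA (fun _ => c) = (c : ℂ) • 1 := by
  have : (Matrix.diagonal (fun _ : Fin n => (c : ℂ))) = (c : ℂ) • 1 := by
    rw [← Matrix.diagonal_one, ← Matrix.diagonal_smul]; congr 1; ext; simp
  rw [specFun, this, map_smul, map_one]

theorem specFun_add (f g : ℝ → ℝ) :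
    specFun hA (fun x => f x + g x) = specFun hA f + specFun hA g := by
  simp only [specFun]; rw [← map_add, Matrix.diagonal_add]; push_cast; rfl

theorem specFun_sub (f g : ℝ → ℝ) :
    specFun hA (fun x => f x - g x) = specFun hA f - specFun hA g := by
  simp only [specFun]; rw [← map_sub, Matrix.diagonal_sub]; push_cast; rfl

theorem specFun_mul (f g : ℝ → ℝ) :
    specFun hA (fun x => f x * g x) = specFun hA f * specFun hA g := by
  simp only [specFun]; rw [← map_mul, Matrix.diagonal_mul_diagonal]; push_cast; rfl

theorem specFun_congr (f g : ℝ → ℝ) (h : ∀ i, f (hA.eigenvalues i) = g (hA.eigenvalues i)) :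
    specFun hA f = specFun hA g := by
  simp only [specFun, h]

theorem specFun_psd (f : ℝ → ℝ) (h : ∀ i, 0 ≤ f (hA.eigenvalues i)) :
    (specFun hA f).PosSemidef := by
  rw [specFun, Unitary.conjStarAlgAut_apply]
  refine Matrix.PosSemidef.mul_mul_conjTranspose_same (Matrix.PosSemidef.diagonal ?_) _
  intro i
  simpa using h i

theorem specFun_herm (f : ℝ → ℝ) : (specFun hA f)ᴴ = specFun hA f := by
  have h : star (specFun hA f) = specFun hA f := by
    rw [specFun, ← map_star, Matrix.star_eq_conjTranspose, Matrix.diagonal_conjTranspose]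
    congr 2; ext; simp
  exact h

theorem specFun_trace (f : ℝ → ℝ) :
    (specFun hA f).trace.re = ∑ i, f (hA.eigenvalues i) := by
  rw [specFun, Unitary.conjStarAlgAut_apply, Matrix.trace_mul_cycle]
  simp [Matrix.trace_diagonal]

end spec

theorem tr_nonneg {n : ℕ} {M : Matrix (Fin n) (Fin n) ℂ} (h : M.PosSemidef) :
    0 ≤ M.trace.re := (Complex.le_def.1 h.trace_nonneg).1

theorem tr_proj_nonneg {n : ℕ} {P M : Matrix (Fin n) (Fin n) ℂ} (hP : Pᴴ = P) (hPP : P * P = P)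
    (h : M.PosSemidef) : 0 ≤ (P * M).trace.re := by
  have := tr_nonneg (h.mul_mul_conjTranspose_same P)
  rwa [hP, Matrix.trace_mul_cycle, hPP] at this

/-- Frobenius bound for the off-diagonal block of a positive matrix. -/
theorem key0 {n : ℕ} {P A : Matrix (Fin n) (Fin n) ℂ} {p : ℝ} (hP : Pᴴ = P) (hPP : P * P = P)
    (hA : Aᴴ = A) (hA2 : ((p : ℂ) • A - A * A).PosSemidef) :
    (P * A * (1 - P) * A).trace.re ≤ p * ((1 - P) * A).trace.re := by
  have hP' : (1 - P)ᴴ = 1 - P := by simp [hP]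
  have hPP' : (1 - P) * (1 - P) = 1 - P := by
    simp [mul_sub, sub_mul, hPP]
  have h1 := tr_proj_nonneg hP' hPP' hA2
  have h2 := tr_nonneg (Matrix.posSemidef_conjTranspose_mul_self ((1 - P) * A * (1 - P)))
  have e2 : (((1 - P) * A * (1 - P))ᴴ * ((1 - P) * A * (1 - P))).trace
      = ((1 - P) * A * A).trace - (P * A * (1 - P) * A).trace := by
    rw [Matrix.conjTranspose_mul, Matrix.conjTranspose_mul, hP', hA]
    have : (1 - P) * (A * (1 - P)) * ((1 - P) * A * (1 - P))
       = ((1 - P) * A * ((1 - P) * (1 - P)) * A) * (1 - P) := by noncomm_ring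
    rw [this, hPP', Matrix.trace_mul_comm]
    have : (1 - P) * ((1 - P) * A * (1 - P) * A) = ((1 - P) * (1 - P)) * A * (1 - P) * A := by
      noncomm_ring
    rw [this, hPP']
    have h3 : (P * A * (1 - P) * A) = P * A * A - P * A * P * A := by noncomm_ring
    have h4 : ((1 - P) * A * (1 - P) * A) = A * A - A * P * A - P * A * A + P * A * P * A := by
      noncomm_ring
    have h5 : ((1 - P) * A * A) = A * A - P * A * A := by noncomm_ring
    have h6 : (A * P * A).trace = (P * A * A).trace := by
      rw [mul_assoc, Matrix.trace_mul_comm]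
    rw [h3, h4, h5]
    simp only [Matrix.trace_sub, Matrix.trace_add, h6]
    ring
  rw [e2] at h2
  rw [mul_sub, ← mul_assoc, Matrix.mul_smul] at h1
  simp only [Matrix.trace_sub, Matrix.trace_smul, Complex.sub_re, smul_eq_mul,
    Complex.re_ofReal_mul] at h1 h2
  linarith

theorem key1 {n : ℕ} {P A D : Matrix (Fin n) (Fin n) ℂ} {s : ℝ} (hs0 : 0 < s) (hs1 : s < 1)
    (hP : Pᴴ = P) (hPP : P * P = P)
    (hA : Aᴴ = A) (hD : Dᴴ = D) (hA2 : (((1 - s : ℝ) : ℂ) • A - A * A).PosSemidef)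
    (hD2 : ((s : ℂ) • D - D * D).PosSemidef) :
    (P * (A - D) * (1 - P) * (A - D)).trace.re ≤ ((1 - P) * A).trace.re + (P * D).trace.re := by
  have hP' : (1 - P)ᴴ = 1 - P := by simp [hP]
  have hPP' : (1 - P) * (1 - P) = 1 - P := by
    simp [mul_sub, sub_mul, hPP]
  have h1 := key0 hP hPP hA hA2
  have h2 := key0 hP' hPP' hD hD2
  rw [sub_sub_cancel] at h2
  have h3 := tr_nonneg (Matrix.posSemidef_conjTranspose_mul_self
    ((1 - P) * ((s : ℂ) • A + ((1 - s : ℝ) : ℂ) • D) * P))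
  have gen : ∀ X : Matrix (Fin n) (Fin n) ℂ, Xᴴ = X →
      (((1 - P) * X * P)ᴴ * ((1 - P) * X * P)).trace = (P * X * (1 - P) * X).trace := by
    intro X hX
    rw [Matrix.conjTranspose_mul, Matrix.conjTranspose_mul, hP', hX, hP]
    have : P * (X * (1 - P)) * ((1 - P) * X * P)
       = (P * X * ((1 - P) * (1 - P)) * X) * P := by noncomm_ring
    rw [this, hPP', Matrix.trace_mul_comm]
    have : P * (P * X * (1 - P) * X) = (P * P) * X * (1 - P) * X := by
      noncomm_ring
    rw [this, hPP]
  rw [gen _ (by simp [hA, hD])] at h3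
  have h4 : ((1 - P) * D * P * D).trace = (P * D * (1 - P) * D).trace := by
    rw [show (1 - P) * D * P * D = ((1 - P) * D) * (P * D) by noncomm_ring,
      Matrix.trace_mul_comm]
    congr 1; noncomm_ring
  rw [h4] at h2
  set x := (P * A * (1 - P) * A).trace with hx
  set y := (P * D * (1 - P) * D).trace with hy
  set z := (P * A * (1 - P) * D).trace with hz
  set w := (P * D * (1 - P) * A).trace with hw
  have e1 : (P * (A - D) * (1 - P) * (A - D)).trace = x - z - w + y := by
    rw [show P * (A - D) * (1 - P) * (A - D) = P * A * (1 - P) * A - P * A * (1 - P) * D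
      - P * D * (1 - P) * A + P * D * (1 - P) * D by noncomm_ring]
    simp only [Matrix.trace_sub, Matrix.trace_add, hx, hy, hz, hw]
  have e2 : (P * ((s : ℂ) • A + ((1 - s : ℝ) : ℂ) • D) * (1 - P) *
      ((s : ℂ) • A + ((1 - s : ℝ) : ℂ) • D)).trace
      = ((s * s : ℝ) : ℂ) * x + ((s * (1 - s) : ℝ) : ℂ) * z + ((s * (1 - s) : ℝ) : ℂ) * w
        + (((1 - s) * (1 - s) : ℝ) : ℂ) * y := by
    simp only [mul_add, add_mul, Matrix.trace_add, Matrix.trace_smul, Matrix.mul_smul,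
      Matrix.smul_mul, smul_eq_mul, ← hx, ← hy, ← hz, ← hw]
    push_cast; ring
  rw [e2] at h3
  rw [e1]
  simp only [Complex.sub_re, Complex.add_re, Complex.re_ofReal_mul] at h3 ⊢
  have hs1' : 0 < 1 - s := by linarith
  have hp : 0 < s * (1 - s) := mul_pos hs0 hs1'
  have h1' := mul_le_mul_of_nonneg_left h1 hs0.le
  have h2' := mul_le_mul_of_nonneg_left h2 hs1'.le
  nlinarith

theorem key2 {n : ℕ} {P X Y : Matrix (Fin n) (Fin n) ℂ} {a b : ℝ}
    (hP : Pᴴ = P) (hPP : P * P = P) (hX : Xᴴ = X) (hY : Yᴴ = Y) :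
    (P * ((Complex.I * ((a * b : ℝ) : ℂ)) • (X * Y - Y * X))).trace.re ≤
      a ^ 2 * (P * X * (1 - P) * X).trace.re + b ^ 2 * (P * Y * (1 - P) * Y).trace.re := by
  have hP' : (1 - P)ᴴ = 1 - P := by simp [hP]
  have hPP' : (1 - P) * (1 - P) = 1 - P := by
    simp [mul_sub, sub_mul, hPP]
  have h := tr_nonneg (Matrix.posSemidef_conjTranspose_mul_self
    ((1 - P) * ((a : ℂ) • X - (Complex.I * b : ℂ) • Y) * P))
  set L := ((a : ℂ) • X - (Complex.I * b : ℂ) • Y) with hL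
  have hLs : Lᴴ = (a : ℂ) • X + (Complex.I * b : ℂ) • Y := by
    simp [hL, hX, hY, sub_eq_add_neg]
  have e1 : (((1 - P) * L * P)ᴴ * ((1 - P) * L * P)).trace = (P * Lᴴ * (1 - P) * L).trace := by
    rw [Matrix.conjTranspose_mul, Matrix.conjTranspose_mul, hP', hP]
    have : P * (Lᴴ * (1 - P)) * ((1 - P) * L * P)
       = (P * Lᴴ * ((1 - P) * (1 - P)) * L) * P := by noncomm_ring
    rw [this, hPP', Matrix.trace_mul_comm]
    have : P * (P * Lᴴ * (1 - P) * L) = (P * P) * Lᴴ * (1 - P) * L := by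
      noncomm_ring
    rw [this, hPP]
  rw [e1, hLs, hL] at h
  have e2 : (P * ((a : ℂ) • X + (Complex.I * b : ℂ) • Y) * (1 - P) *
      ((a : ℂ) • X - (Complex.I * b : ℂ) • Y)).trace
      = ((a ^ 2 : ℝ) : ℂ) * (P * X * (1 - P) * X).trace
        + ((b ^ 2 : ℝ) : ℂ) * (P * Y * (1 - P) * Y).trace
        - (Complex.I * ((a * b : ℝ) : ℂ)) *
          ((P * X * (1 - P) * Y).trace - (P * Y * (1 - P) * X).trace) := by
    rw [mul_sub]
    simp only [mul_add, add_mul, Matrix.trace_add, Matrix.trace_sub, Matrix.trace_smul,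
      Matrix.mul_smul, Matrix.smul_mul, smul_eq_mul]
    push_cast
    linear_combination (-(b : ℂ) ^ 2 * (P * Y * (1 - P) * Y).trace) * Complex.I_mul_I
  have e3 : (P * X * (1 - P) * Y).trace - (P * Y * (1 - P) * X).trace
      = (P * (X * Y - Y * X)).trace := by
    have h1 : (P * X * P * Y).trace = (P * Y * P * X).trace := by
      rw [mul_assoc (P * X), Matrix.trace_mul_comm]; congr 1; noncomm_ring
    rw [show P * X * (1 - P) * Y = P * X * Y - P * X * P * Y by noncomm_ring,
      show P * Y * (1 - P) * X = P * Y * X - P * Y * P * X by noncomm_ring,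
      show P * (X * Y - Y * X) = P * X * Y - P * Y * X by noncomm_ring]
    simp only [Matrix.trace_sub, h1]
    ring
  rw [e2, e3] at h
  rw [Matrix.mul_smul, Matrix.trace_smul, smul_eq_mul]
  simp only [Complex.sub_re, Complex.add_re, Complex.re_ofReal_mul] at h
  linarith

theorem decomp {n : ℕ} {A : Matrix (Fin n) (Fin n) ℂ} (hA : A.IsHermitian)
    (h0 : ∀ i, 0 ≤ hA.eigenvalues i) (h1 : ∀ i, hA.eigenvalues i ≤ 1) {s : ℝ}
    (hs0 : 0 < s) (hs1 : s < 1) :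
    ∃ B D : Matrix (Fin n) (Fin n) ℂ, Bᴴ = B ∧ Dᴴ = D ∧ A = (s : ℂ) • 1 + (B - D) ∧
      (((1 - s : ℝ) : ℂ) • B - B * B).PosSemidef ∧ ((s : ℂ) • D - D * D).PosSemidef ∧
      B.trace.re = ∑ i, max (hA.eigenvalues i - s) 0 := by
  refine ⟨specFun hA (fun x => max (x - s) 0), specFun hA (fun x => max (s - x) 0),
    specFun_herm _ _, specFun_herm _ _, ?_, ?_, ?_, specFun_trace _ _⟩
  · rw [← specFun_const hA s, ← specFun_sub, ← specFun_add]
    conv_lhs => rw [← specFun_id hA]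
    apply specFun_congr
    intro i
    rcases le_total (hA.eigenvalues i) s with h | h
    · rw [max_eq_right (by linarith), max_eq_left (by linarith)]; ring
    · rw [max_eq_left (by linarith), max_eq_right (by linarith)]; ring
  · have := specFun_psd hA (fun x => (1 - s) * max (x - s) 0 - max (x - s) 0 * max (x - s) 0) (by
      intro i
      have hm : max (hA.eigenvalues i - s) 0 ≤ 1 - s := max_le (by linarith [h1 i]) (by linarith)
      have hm0 : 0 ≤ max (hA.eigenvalues i - s) 0 := le_max_right _ _
      nlinarith)
    rwa [specFun_sub, specFun_mul, specFun_mul, specFun_const, smul_mul_assoc, one_mul] at this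
  · have := specFun_psd hA (fun x => s * max (s - x) 0 - max (s - x) 0 * max (s - x) 0) (by
      intro i
      have hm : max (s - hA.eigenvalues i) 0 ≤ s := max_le (by linarith [h0 i]) (by linarith)
      have hm0 : 0 ≤ max (s - hA.eigenvalues i) 0 := le_max_right _ _
      nlinarith)
    rwa [specFun_sub, specFun_mul, specFun_mul, specFun_const, smul_mul_assoc, one_mul] at this

theorem exists_proj {n : ℕ} {A : Matrix (Fin n) (Fin n) ℂ} (hA : A.IsHermitian) (s : ℝ) :
    ∃ P : Matrix (Fin n) (Fin n) ℂ, Pᴴ = P ∧ P * P = P ∧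
      (P * (A - (s : ℂ) • 1)).trace.re = ∑ i, max (hA.eigenvalues i - s) 0 := by
  classical
  refine ⟨specFun hA (fun x => if s < x then 1 else 0), specFun_herm _ _, ?_, ?_⟩
  · rw [← specFun_mul]
    apply specFun_congr
    intro i; simp
  · have : A - (s : ℂ) • 1 = specFun hA (fun x => x - s) := by
      rw [specFun_sub, specFun_id, specFun_const]
    rw [this, ← specFun_mul, specFun_trace]
    refine Finset.sum_congr rfl fun i _ => ?_
    split_ifs with h
    · rw [max_eq_left (by linarith)]; ring
    · rw [max_eq_right (by linarith)]; ring

theorem layer {n : ℕ} (t : ℝ) (ht : t ∈ Set.Icc (0 : ℝ) 1)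
    (ρ σ : Matrix (Fin n) (Fin n) ℂ) (hρ : ρ.IsHermitian) (hσ : σ.IsHermitian)
    (hρ0 : ∀ i, 0 ≤ hρ.eigenvalues i) (hρ1 : ∀ i, hρ.eigenvalues i ≤ 1)
    (hσ0 : ∀ i, 0 ≤ hσ.eigenvalues i) (hσ1 : ∀ i, hσ.eigenvalues i ≤ 1)
    (hC : (pswap t ρ σ).IsHermitian) {s : ℝ} (hs0 : 0 < s) (hs1 : s < 1) :
    ∑ i, max (hC.eigenvalues i - s) 0 ≤
      t * ∑ i, max (hρ.eigenvalues i - s) 0 + (1 - t) * ∑ i, max (hσ.eigenvalues i - s) 0 := by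
  obtain ⟨A, D, hA, hD, hX, hA2, hD2, hAt⟩ := decomp hρ hρ0 hρ1 hs0 hs1
  obtain ⟨B, E, hB, hE, hY, hB2, hE2, hBt⟩ := decomp hσ hσ0 hσ1 hs0 hs1
  obtain ⟨P, hP, hPP, hPt⟩ := exists_proj hC s
  have k1 := key1 hs0 hs1 hP hPP hA hD hA2 hD2
  have k2 := key1 hs0 hs1 hP hPP hB hE hB2 hE2
  have k3 := key2 (a := √t) (b := √(1 - t)) hP hPP (X := A - D) (Y := B - E)
    (by simp [hA, hD]) (by simp [hB, hE])
  have ht0 := ht.1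
  have ht1 : 0 ≤ 1 - t := by linarith [ht.2]
  rw [Real.sq_sqrt ht0, Real.sq_sqrt ht1, ← Real.sqrt_mul ht0] at k3
  rw [← hPt, ← hAt, ← hBt]
  have eC : pswap t ρ σ - (s : ℂ) • 1 = (t : ℂ) • (A - D) + ((1 - t : ℝ) : ℂ) • (B - E)
      + (Complex.I * (Real.sqrt (t * (1 - t)) : ℂ)) •
        ((A - D) * (B - E) - (B - E) * (A - D)) := by
    have hcomm : ρ * σ - σ * ρ = (A - D) * (B - E) - (B - E) * (A - D) := by
      rw [hX, hY]
      simp only [mul_add, add_mul, smul_mul_assoc, mul_smul_comm, one_mul, mul_one,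
        smul_add]
      abel
    rw [pswap, hcomm, hX, hY]
    push_cast
    module
  rw [eC, mul_add, mul_add, Matrix.trace_add, Matrix.trace_add, Complex.add_re, Complex.add_re]
  have m1 := mul_le_mul_of_nonneg_left k1 ht0
  have m2 := mul_le_mul_of_nonneg_left k2 ht1
  simp only [Matrix.mul_smul _ (t : ℂ), Matrix.mul_smul _ ((1 - t : ℝ) : ℂ), Matrix.trace_smul,
    smul_eq_mul, Complex.re_ofReal_mul, mul_sub P, sub_mul 1 P, one_mul, Matrix.trace_sub,
    Complex.sub_re] at m1 m2 k3 ⊢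
  linarith

theorem pswap_psd {n : ℕ} (t : ℝ) (ht : t ∈ Set.Icc (0 : ℝ) 1)
    (ρ σ : Matrix (Fin n) (Fin n) ℂ) (hρ : ρ.IsHermitian) (hσ : σ.IsHermitian)
    (hρ0 : ∀ i, 0 ≤ hρ.eigenvalues i) (hρ1 : ∀ i, hρ.eigenvalues i ≤ 1)
    (hσ0 : ∀ i, 0 ≤ hσ.eigenvalues i) (hσ1 : ∀ i, hσ.eigenvalues i ≤ 1) :
    (pswap t ρ σ).PosSemidef := by
  have aux : ∀ {A : Matrix (Fin n) (Fin n) ℂ} (hA : A.IsHermitian),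
      (∀ i, 0 ≤ hA.eigenvalues i) → (∀ i, hA.eigenvalues i ≤ 1) → (A - A * A).PosSemidef := by
    intro A hA h0 h1
    have := specFun_psd hA (fun x => x - x * x) (fun i => by
      have := h0 i; have := h1 i; nlinarith)
    rwa [specFun_sub, specFun_mul, specFun_id] at this
  have ht0 := ht.1
  have ht1 : 0 ≤ 1 - t := by linarith [ht.2]
  have p1 := (aux hρ hρ0 hρ1).smul (a := (t : ℂ)) (by exact_mod_cast ht0)
  have p2 := (aux hσ hσ0 hσ1).smul (a := ((1 - t : ℝ) : ℂ)) (by exact_mod_cast ht1)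
  have p3 := Matrix.posSemidef_conjTranspose_mul_self
    ((√t : ℂ) • ρ + (Complex.I * (√(1 - t) : ℝ) : ℂ) • σ)
  have h := (p1.add p2).add p3
  convert h using 1
  have e1 : ((√t : ℝ) : ℂ) * (√t : ℝ) = t := by
    rw [← Complex.ofReal_mul, Real.mul_self_sqrt ht0]
  have e2 : ((√(1 - t) : ℝ) : ℂ) * (√(1 - t) : ℝ) = (1 - t : ℝ) := by
    rw [← Complex.ofReal_mul, Real.mul_self_sqrt ht1]
  have e3 : ((√t : ℝ) : ℂ) * (√(1 - t) : ℝ) = (√(t * (1 - t)) : ℝ) := by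
    rw [← Complex.ofReal_mul, Real.sqrt_mul ht0]
  rw [pswap, ← e3]
  have hL : ((√t : ℂ) • ρ + (Complex.I * (√(1 - t) : ℝ) : ℂ) • σ)ᴴ
      = (√t : ℂ) • ρ - (Complex.I * (√(1 - t) : ℝ) : ℂ) • σ := by
    simp [hρ.eq, hσ.eq, sub_eq_add_neg]
  rw [hL, ← e1, ← e2]
  simp only [mul_add, sub_mul, smul_sub, smul_mul_assoc, mul_smul_comm, smul_smul]
  have e4 : (Complex.I * ((√(1 - t) : ℝ) : ℂ)) * (Complex.I * ((√(1 - t) : ℝ) : ℂ))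
     = - (((√(1 - t) : ℝ) : ℂ) * (√(1 - t) : ℝ)) := by
    linear_combination (((√(1 - t) : ℝ) : ℂ) * (√(1 - t) : ℝ)) * Complex.I_mul_I
  rw [e4]
  module

theorem min_integrable (x : ℝ) (hx0 : 0 ≤ x) :
    IntervalIntegrable (fun s : ℝ => min x s / s) MeasureTheory.volume 0 1 := by
  refine (intervalIntegrable_const (c := (1 : ℝ))).mono_fun ?_ ?_
  · exact Measurable.aestronglyMeasurable (by fun_prop)
  · rw [Set.uIoc_of_le zero_le_one]
    filter_upwards [MeasureTheory.ae_restrict_mem measurableSet_Ioc] with s hs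
    rw [Real.norm_of_nonneg (div_nonneg (le_min hx0 hs.1.le) hs.1.le), norm_one,
      div_le_one hs.1]
    exact min_le_right _ _

theorem min_integral (x : ℝ) (hx0 : 0 ≤ x) (hx1 : x ≤ 1) :
    ∫ s in (0 : ℝ)..1, min x s / s = Real.negMulLog x + x := by
  rcases hx0.eq_or_lt with rfl | hx
  · have : ∫ s in (0 : ℝ)..1, min 0 s / s = ∫ s in (0 : ℝ)..1, (0 : ℝ) := by
      apply intervalIntegral.integral_congr
      intro s hs
      rw [Set.uIcc_of_le zero_le_one] at hs
      simp [min_eq_left hs.1]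
    rw [this]; simp
  · have hi := min_integrable x hx0
    rw [← intervalIntegral.integral_add_adjacent_intervals (b := x)
      (hi.mono_set (by
        rw [Set.uIcc_of_le hx0, Set.uIcc_of_le zero_le_one]; exact Set.Icc_subset_Icc_right hx1))
      (hi.mono_set (by
        rw [Set.uIcc_of_le hx1, Set.uIcc_of_le zero_le_one]; exact Set.Icc_subset_Icc_left hx0))]
    have h1 : ∫ s in (0 : ℝ)..x, min x s / s = ∫ s in (0 : ℝ)..x, (1 : ℝ) := by
      apply intervalIntegral.integral_congr_ae
      refine Filter.Eventually.of_forall fun s hs => ?_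
      rw [Set.uIoc_of_le hx0] at hs
      rw [min_eq_right hs.2, div_self hs.1.ne']
    have h2 : ∫ s in x..1, min x s / s = ∫ s in x..1, x * (1 / s) := by
      apply intervalIntegral.integral_congr
      intro s hs
      rw [Set.uIcc_of_le hx1] at hs
      simp only [min_eq_left hs.1]; ring
    rw [h1, h2, intervalIntegral.integral_const_mul, integral_one_div_of_pos hx one_pos]
    simp [Real.negMulLog]
    ring

theorem sum_integrable {n : ℕ} (l : Fin n → ℝ) (h0 : ∀ i, 0 ≤ l i) :
    IntervalIntegrable (fun s : ℝ => ∑ i, min (l i) s / s) MeasureTheory.volume 0 1 := by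
  have := IntervalIntegrable.sum Finset.univ fun i _ => min_integrable (l i) (h0 i)
  have e : (fun s : ℝ => ∑ i, min (l i) s / s) = ∑ i, fun s : ℝ => min (l i) s / s := by
    funext s
    simp
  rw [e]
  exact this

theorem entropy_integral {n : ℕ} (l : Fin n → ℝ) (h0 : ∀ i, 0 ≤ l i) (h1 : ∀ i, l i ≤ 1)
    (hsum : ∑ i, l i = 1) :
    ∑ i, Real.negMulLog (l i) = (∫ s in (0 : ℝ)..1, ∑ i, min (l i) s / s) - 1 := by
  rw [intervalIntegral.integral_finsetSum (fun i _ => min_integrable _ (h0 i)),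
    Finset.sum_congr rfl (fun i _ => min_integral _ (h0 i) (h1 i)), Finset.sum_add_distrib, hsum]
  ring

theorem eig_sum {n : ℕ} {A : Matrix (Fin n) (Fin n) ℂ} (hA : A.IsHermitian) (h : A.trace = 1) :
    ∑ i, hA.eigenvalues i = 1 := by
  have := hA.trace_eq_sum_eigenvalues
  rw [h] at this
  have h2 := congrArg Complex.re this
  simpa using h2.symm

theorem stmt_11 {n : ℕ} (t : ℝ) (ht : t ∈ Set.Icc (0 : ℝ) 1)
    (ρ σ : Matrix (Fin n) (Fin n) ℂ)
    (hρ : ρ.PosSemidef) (hσ : σ.PosSemidef)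
    (hρ1 : ρ.trace = 1) (hσ1 : σ.trace = 1)
    (hC : (pswap t ρ σ).IsHermitian) :
    t * vnEntropy hρ.isHermitian + (1 - t) * vnEntropy hσ.isHermitian ≤ vnEntropy hC := by
  have le1 : ∀ l : Fin n → ℝ, (∀ i, 0 ≤ l i) → ∑ i, l i = 1 → ∀ i, l i ≤ 1 := by
    intro l h0 hs i
    rw [← hs]
    exact Finset.single_le_sum (fun j _ => h0 j) (Finset.mem_univ i)
  have a0 := hρ.eigenvalues_nonneg
  have as := eig_sum hρ.isHermitian hρ1
  have a1 := le1 _ a0 as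
  have b0 := hσ.eigenvalues_nonneg
  have bs := eig_sum hσ.isHermitian hσ1
  have b1 := le1 _ b0 bs
  have hpsd := pswap_psd t ht ρ σ hρ.isHermitian hσ.isHermitian a0 a1 b0 b1
  have c0 : ∀ i, 0 ≤ hC.eigenvalues i := hpsd.eigenvalues_nonneg
  have hCtr : (pswap t ρ σ).trace = 1 := by
    simp only [pswap, Matrix.trace_add, Matrix.trace_smul, Matrix.trace_sub, hρ1, hσ1,
      Matrix.trace_mul_comm σ ρ]
    simp
  have cs := eig_sum hC hCtr
  have c1 := le1 _ c0 cs
  unfold vnEntropy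
  rw [entropy_integral _ a0 a1 as, entropy_integral _ b0 b1 bs, entropy_integral _ c0 c1 cs]
  have key : ∫ s in (0 : ℝ)..1, (t * ∑ i, min (hρ.isHermitian.eigenvalues i) s / s
        + (1 - t) * ∑ i, min (hσ.isHermitian.eigenvalues i) s / s)
      ≤ ∫ s in (0 : ℝ)..1, ∑ i, min (hC.eigenvalues i) s / s := by
    apply intervalIntegral.integral_mono_on_of_le_Ioo zero_le_one
    · exact ((sum_integrable _ a0).const_mul _).add
        ((sum_integrable _ b0).const_mul _)
    · exact sum_integrable _ c0
    · intro s hs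
      have hl := layer t ht ρ σ hρ.isHermitian hσ.isHermitian a0 a1 b0 b1 hC hs.1 hs.2
      have conv : ∀ l : Fin n → ℝ, ∑ i, l i = 1 →
          ∑ i, min (l i) s = 1 - ∑ i, max (l i - s) 0 := by
        intro l hl
        rw [← hl, ← Finset.sum_sub_distrib]
        refine Finset.sum_congr rfl fun i _ => ?_
        rcases le_total (l i) s with h | h
        · rw [min_eq_left h, max_eq_right (by linarith)]; ring
        · rw [min_eq_right h, max_eq_left (by linarith)]; ring
      simp only [← Finset.sum_div]
      rw [← mul_div_assoc, ← mul_div_assoc, ← add_div]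
      apply div_le_div_of_nonneg_right _ hs.1.le
      rw [conv _ as, conv _ bs, conv _ cs]
      linarith
  rw [intervalIntegral.integral_add
    ((sum_integrable _ a0).const_mul _)
    ((sum_integrable _ b0).const_mul _),
    intervalIntegral.integral_const_mul, intervalIntegral.integral_const_mul] at key
  linarith
end

section
/- For density matrices ρ, σ on a finite-dimensional Hilbert space and t ∈ (0,1), equality S(ρ ⋆_t σ) = t·S(ρ) + (1−t)·S(σ) holds if and only if ρ = σ. -/
open Matrix ComplexOrder

lemma hinge_integral (x : ℝ) (h0 : 0 ≤ x) (h1 : x ≤ 1) :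
    IntervalIntegrable (fun a : ℝ => max (a - x) 0 * (a⁻¹ - 1)) MeasureTheory.volume 0 1 ∧
    ∫ a in (0:ℝ)..1, max (a - x) 0 * (a⁻¹ - 1) = x * Real.log x - x ^ 2 / 2 + 1 / 2 := by
  rcases h0.eq_or_lt with rfl | hx
  · have hcg : Set.EqOn (fun a : ℝ => 1 - a) (fun a : ℝ => max (a - 0) 0 * (a⁻¹ - 1))
        (Set.uIoc 0 1) := by
      intro a ha
      rw [Set.uIoc_of_le zero_le_one] at ha
      have : a ≠ 0 := ha.1.ne'
      simp only [sub_zero, max_eq_left ha.1.le]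
      field_simp
    constructor
    · exact (Continuous.intervalIntegrable (by fun_prop) 0 1).congr hcg
    · rw [← intervalIntegral.integral_congr_ae (Filter.Eventually.of_forall fun _ h => hcg h)]
      rw [intervalIntegral.integral_sub (by simp) (by simp)]
      norm_num
  · have hcg1 : Set.EqOn (fun a : ℝ => (0:ℝ)) (fun a : ℝ => max (a - x) 0 * (a⁻¹ - 1))
        (Set.uIoc 0 x) := by
      intro a ha
      rw [Set.uIoc_of_le h0] at ha
      simp only [max_eq_right (sub_nonpos.2 ha.2), zero_mul]
    have hcg2 : Set.EqOn (fun a : ℝ => (a - x) * (a⁻¹ - 1))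
        (fun a : ℝ => max (a - x) 0 * (a⁻¹ - 1)) (Set.uIoc x 1) := by
      intro a ha
      rw [Set.uIoc_of_le h1] at ha
      simp only [max_eq_left (sub_nonneg.2 ha.1.le)]
    have i1 : IntervalIntegrable (fun a : ℝ => max (a - x) 0 * (a⁻¹ - 1))
        MeasureTheory.volume 0 x :=
      (Continuous.intervalIntegrable (by fun_prop) 0 x).congr hcg1
    have i2' : IntervalIntegrable (fun a : ℝ => (a - x) * (a⁻¹ - 1))
        MeasureTheory.volume x 1 := by
      apply ContinuousOn.intervalIntegrable
      rw [Set.uIcc_of_le h1]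
      apply ContinuousOn.mul (by fun_prop)
      apply ContinuousOn.sub _ (by fun_prop)
      apply ContinuousOn.inv₀ (by fun_prop)
      intro a ha
      exact (lt_of_lt_of_le hx ha.1).ne'
    have i2 := i2'.congr hcg2
    refine ⟨i1.trans i2, ?_⟩
    rw [← intervalIntegral.integral_add_adjacent_intervals i1 i2,
      ← intervalIntegral.integral_congr_ae (Filter.Eventually.of_forall fun _ h => hcg1 h), ← intervalIntegral.integral_congr_ae (Filter.Eventually.of_forall fun _ h => hcg2 h),
      intervalIntegral.integral_eq_sub_of_hasDerivAt
        (f := fun a : ℝ => a - a ^ 2 / 2 - x * Real.log a + x * a) _ i2']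
    · simp; ring
    · intro a ha
      rw [Set.uIcc_of_le h1] at ha
      have ha0 : a ≠ 0 := (lt_of_lt_of_le hx ha.1).ne'
      have := (((hasDerivAt_id' a).fun_sub ((hasDerivAt_pow 2 a).div_const 2)).fun_sub
        ((Real.hasDerivAt_log ha0).const_mul x)).fun_add ((hasDerivAt_id' a).const_mul x)
      refine this.congr_deriv ?_
      simp
      field_simp
      ring

lemma key_real {n : ℕ} (w : Fin n → Fin n → ℝ) (α p : Fin n → ℝ) (hw : ∀ i j, 0 ≤ w i j)
    (hs : ∀ i j, w i j = w j i) (hp : ∀ i, ∑ j, w i j = p i) (hd : ∀ i, w i i = p i ^ 2)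
    (hα : ∀ i j, |α i - α j| ≤ 1) :
    ∑ i, p i * α i + (∑ i, p i * α i ^ 2 - ∑ i, ∑ j, w i j * α i * α j) ≤ ∑ i, max (α i) 0 := by
  have e1 : ∑ i, p i * α i ^ 2 = ∑ i, ∑ j, w i j * α i ^ 2 := by
    simp only [← hp, Finset.sum_mul]
  have e2 : ∑ i, p i * α i ^ 2 = ∑ i, ∑ j, w i j * α j ^ 2 := by
    rw [e1, Finset.sum_comm]
    refine Finset.sum_congr rfl fun i _ => Finset.sum_congr rfl fun j _ => by rw [hs]
  have e3 : ∑ i, p i * |α i| = ∑ i, ∑ j, w i j * |α i| := by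
    simp only [← hp, Finset.sum_mul]
  have e4 : ∑ i, p i * |α i| = ∑ i, ∑ j, w i j * |α j| := by
    rw [e3, Finset.sum_comm]
    refine Finset.sum_congr rfl fun i _ => Finset.sum_congr rfl fun j _ => by rw [hs]
  have e5 : ∑ i, p i ^ 2 * |α i| = ∑ i, ∑ j, if i = j then w i j * |α i| else 0 := by
    simp [hd]
  have main : ∑ i, ∑ j, (w i j * α i ^ 2 + w i j * α j ^ 2 - 2 * (w i j * α i * α j)) ≤
      ∑ i, ∑ j, (w i j * |α i| + w i j * |α j| - 2 * (if i = j then w i j * |α i| else 0)) := by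
    refine Finset.sum_le_sum fun i _ => Finset.sum_le_sum fun j _ => ?_
    split_ifs with h
    · subst h; apply le_of_eq; ring
    · have h1 := hα i j
      have h2 : (α i - α j) ^ 2 ≤ |α i| + |α j| := by
        rw [← sq_abs]
        have := abs_nonneg (α i - α j)
        have := abs_sub (α i) (α j)
        nlinarith
      nlinarith [mul_le_mul_of_nonneg_left h2 (hw i j)]
  simp only [Finset.sum_sub_distrib, Finset.sum_add_distrib, ← Finset.mul_sum] at main
  rw [← e1, ← e2, ← e3, ← e4, ← e5] at main
  have fin : ∑ i, (p i * α i + p i * |α i| - p i ^ 2 * |α i|) ≤ ∑ i, max (α i) 0 := by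
    refine Finset.sum_le_sum fun i _ => ?_
    rcases le_total 0 (α i) with h | h
    · rw [abs_of_nonneg h, max_eq_left h]
      nlinarith [mul_nonneg h (sq_nonneg (1 - p i))]
    · rw [abs_of_nonpos h, max_eq_right h]
      nlinarith [mul_nonneg (neg_nonneg.2 h) (sq_nonneg (p i))]
  simp only [Finset.sum_sub_distrib, Finset.sum_add_distrib] at fin
  linarith

lemma spec_decomp {n : ℕ} {A : Matrix (Fin n) (Fin n) ℂ} (hA : A.IsHermitian) :
    ∃ V : Matrix (Fin n) (Fin n) ℂ, V * Vᴴ = 1 ∧ Vᴴ * V = 1 ∧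
      A = V * diagonal (fun i => (hA.eigenvalues i : ℂ)) * Vᴴ := by
  refine ⟨hA.eigenvectorUnitary, ?_, ?_, ?_⟩
  · exact Unitary.mul_star_self_of_mem hA.eigenvectorUnitary.2
  · exact Unitary.star_mul_self_of_mem hA.eigenvectorUnitary.2
  · exact hA.spectral_theorem

lemma key_mat {n : ℕ} (V P : Matrix (Fin n) (Fin n) ℂ) (α : Fin n → ℝ) (hV : V * Vᴴ = 1)
    (hV' : Vᴴ * V = 1) (hP : Pᴴ = P) (hPP : P * P = P) (hα : ∀ i j, |α i - α j| ≤ 1)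
    (A : Matrix (Fin n) (Fin n) ℂ) (hA : A = V * diagonal (fun i => (α i : ℂ)) * Vᴴ) :
    ((P * A).trace + ((P * A * A).trace - (P * A * P * A).trace)).re ≤ ∑ i, max (α i) 0 := by
  set D : Matrix (Fin n) (Fin n) ℂ := diagonal (fun i => (α i : ℂ)) with hD
  set R := Vᴴ * P * V with hR
  have hRR : R * R = R := by
    calc R * R = Vᴴ * P * (V * Vᴴ) * P * V := by simp only [hR, Matrix.mul_assoc]
      _ = R := by rw [hV, Matrix.mul_one, Matrix.mul_assoc Vᴴ, hPP]
  have hRH : Rᴴ = R := by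
    simp only [hR, conjTranspose_mul, conjTranspose_conjTranspose, hP, Matrix.mul_assoc]
  have t1 : (P * A).trace = (R * D).trace := by
    rw [hA, ← Matrix.mul_assoc, Matrix.trace_mul_comm]
    simp only [hR, Matrix.mul_assoc]
  have t2 : (P * A * A).trace = (R * D * D).trace := by
    have : P * A * A = P * V * D * (Vᴴ * V) * D * Vᴴ := by
      rw [hA]; simp only [Matrix.mul_assoc]
    rw [this, hV', Matrix.mul_one, Matrix.trace_mul_comm]
    simp only [hR, Matrix.mul_assoc]
  have t3 : (P * A * P * A).trace = (R * D * R * D).trace := by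
    have : P * A * P * A = P * V * D * Vᴴ * P * V * D * Vᴴ := by
      rw [hA]; simp only [Matrix.mul_assoc]
    rw [this, Matrix.trace_mul_comm]
    simp only [hR, Matrix.mul_assoc]
  have hconj : ∀ i j, R j i = star (R i j) := by
    intro i j
    conv_lhs => rw [← hRH]
    rfl
  have hpr : ∀ i, (∑ j, (Complex.normSq (R i j)) : ℝ) = (R i i).re := by
    intro i
    conv_rhs => rw [← hRR]
    rw [Matrix.mul_apply, Complex.re_sum]
    refine Finset.sum_congr rfl fun j _ => ?_
    rw [hconj i j]
    simp [Complex.normSq_apply]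
  have him : ∀ i, (R i i).im = 0 := by
    intro i
    have := congrArg Complex.im (hconj i i)
    simp at this
    linarith
  have := key_real (fun i j => Complex.normSq (R i j)) α (fun i => (R i i).re)
    (fun i j => Complex.normSq_nonneg _)
    (fun i j => by rw [hconj i j]; exact (Complex.normSq_conj _).symm) hpr
    (fun i => by simp [Complex.normSq_apply, him, sq]) hα
  refine le_trans (le_of_eq ?_) this
  rw [t1, t2, t3]
  simp only [Complex.add_re, Complex.sub_re]
  congr 1
  · simp [Matrix.trace, hD, Matrix.mul_diagonal]
  · congr 1
    · simp only [Matrix.trace, hD, Matrix.mul_diagonal, Matrix.diag, Complex.re_sum]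
      refine Finset.sum_congr rfl fun i _ => ?_
      simp; ring
    · simp only [Matrix.trace, Matrix.diag, Complex.re_sum]
      refine Finset.sum_congr rfl fun i _ => ?_
      rw [hD, Matrix.mul_diagonal, Matrix.mul_apply, Finset.sum_mul, Complex.re_sum]
      refine Finset.sum_congr rfl fun j _ => ?_
      rw [Matrix.mul_diagonal, hconj i j]
      simp [Complex.normSq_apply]
      ring

lemma hinge_core {n : ℕ} (x y : ℝ) (P A B : Matrix (Fin n) (Fin n) ℂ) (hP : Pᴴ = P)
    (hPP : P * P = P) (hA : Aᴴ = A) (hB : Bᴴ = B) :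
    ((P * (((x ^ 2 : ℝ) : ℂ) • A + ((y ^ 2 : ℝ) : ℂ) • B
      - (Complex.I * ((x * y : ℝ) : ℂ)) • (A * B - B * A))).trace).re ≤
    x ^ 2 * ((P * A).trace + ((P * A * A).trace - (P * A * P * A).trace)).re
    + y ^ 2 * ((P * B).trace + ((P * B * B).trace - (P * B * P * B).trace)).re := by
  set M : Matrix (Fin n) (Fin n) ℂ := (x : ℂ) • A + (Complex.I * (y : ℂ)) • B with hM
  have hMH : Mᴴ = (x : ℂ) • A - (Complex.I * (y : ℂ)) • B := by
    simp [hM, hA, hB, sub_eq_add_neg]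
  have hpos : 0 ≤ (((1 - P) * M * P)ᴴ * ((1 - P) * M * P)).trace :=
    (Matrix.posSemidef_conjTranspose_mul_self _).trace_nonneg
  have hQ : (1 - P)ᴴ * (1 - P) = 1 - P := by
    simp [hP, Matrix.sub_mul, Matrix.mul_sub, hPP]
  have e : (((1 - P) * M * P)ᴴ * ((1 - P) * M * P)).trace
      = (P * Mᴴ * M).trace - (P * Mᴴ * P * M).trace := by
    have : ((1 - P) * M * P)ᴴ * ((1 - P) * M * P) = P * Mᴴ * ((1 - P)ᴴ * (1 - P)) * M * P := by
      rw [conjTranspose_mul, conjTranspose_mul, hP]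
      simp only [Matrix.mul_assoc]
    rw [this, hQ, Matrix.trace_mul_comm, ← Matrix.trace_sub]
    congr 1
    simp only [← Matrix.mul_assoc, hPP, Matrix.mul_sub, Matrix.sub_mul, Matrix.mul_one]
  rw [e] at hpos
  have c1 : (P * B * P * A).trace = (P * A * P * B).trace := by
    rw [Matrix.mul_assoc (P * B), Matrix.trace_mul_comm, Matrix.mul_assoc (P * A)]
  have key : (P * (((x ^ 2 : ℝ) : ℂ) • A + ((y ^ 2 : ℝ) : ℂ) • B
      - (Complex.I * ((x * y : ℝ) : ℂ)) • (A * B - B * A))).trace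
      = ((x ^ 2 : ℝ) : ℂ) * ((P * A).trace + ((P * A * A).trace - (P * A * P * A).trace))
      + ((y ^ 2 : ℝ) : ℂ) * ((P * B).trace + ((P * B * B).trace - (P * B * P * B).trace))
      - ((P * Mᴴ * M).trace - (P * Mᴴ * P * M).trace) := by
    rw [hMH, hM]
    simp only [Matrix.mul_add, Matrix.mul_sub, Matrix.add_mul, Matrix.sub_mul, Matrix.mul_smul,
      Matrix.smul_mul, Matrix.trace_add, Matrix.trace_sub, Matrix.trace_smul, smul_eq_mul,
      ← Matrix.mul_assoc, c1]
    push_cast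
    have := Complex.I_sq
    linear_combination (-(y:ℂ)^2 * ((P * B * B).trace - (P * B * P * B).trace)) * this
  rw [key]
  have h2 := (Complex.le_def.1 hpos).1
  simp only [Complex.sub_re, Complex.add_re, Complex.re_ofReal_mul, Complex.zero_re] at h2 ⊢
  linarith

lemma hinge_ineq {n : ℕ} (t : ℝ) (ht : t ∈ Set.Ioo (0 : ℝ) 1)
    (ρ σ : Matrix (Fin n) (Fin n) ℂ) (hρ : ρ.IsHermitian) (hσ : σ.IsHermitian)
    (hC : (pswap t ρ σ).IsHermitian)
    (hr : ∀ i j, |hρ.eigenvalues i - hρ.eigenvalues j| ≤ 1)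
    (hs : ∀ i j, |hσ.eigenvalues i - hσ.eigenvalues j| ≤ 1) (a : ℝ) :
    ∑ i, max (a - hC.eigenvalues i) 0 ≤ t * ∑ i, max (a - hρ.eigenvalues i) 0
      + (1 - t) * ∑ i, max (a - hσ.eigenvalues i) 0 := by
  have shift : ∀ (M : Matrix (Fin n) (Fin n) ℂ) (hM : M.IsHermitian)
      (V : Matrix (Fin n) (Fin n) ℂ), V * Vᴴ = 1 →
      M = V * diagonal (fun i => (hM.eigenvalues i : ℂ)) * Vᴴ →
      (a : ℂ) • (1 : Matrix (Fin n) (Fin n) ℂ) - M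
        = V * diagonal (fun i => ((a - hM.eigenvalues i : ℝ) : ℂ)) * Vᴴ := by
    intro M hM V hV h
    have : diagonal (fun i => ((a - hM.eigenvalues i : ℝ) : ℂ))
        = (a : ℂ) • (1 : Matrix (Fin n) (Fin n) ℂ)
          - diagonal (fun i => (hM.eigenvalues i : ℂ)) := by
      ext i j
      by_cases hij : i = j
      · subst hij; simp
      · simp [hij]
    rw [this, Matrix.mul_sub, Matrix.sub_mul, ← h]
    simp [hV]
  obtain ⟨V, hV, hV', eV⟩ := spec_decomp hρ
  obtain ⟨W, hW, hW', eW⟩ := spec_decomp hσ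
  obtain ⟨U, hU, hU', eU⟩ := spec_decomp hC
  have eA := shift ρ hρ V hV eV
  have eB := shift σ hσ W hW eW
  have eC := shift _ hC U hU eU
  set A := (a : ℂ) • (1 : Matrix (Fin n) (Fin n) ℂ) - ρ with hA
  set B := (a : ℂ) • (1 : Matrix (Fin n) (Fin n) ℂ) - σ with hB
  set E : Matrix (Fin n) (Fin n) ℂ :=
    diagonal (fun i => if hC.eigenvalues i < a then (1 : ℂ) else 0) with hE
  set P := U * E * Uᴴ with hPdef
  have hEE : E * E = E := by
    rw [hE, Matrix.diagonal_mul_diagonal]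
    congr 1; ext i; simp
  have hEH : Eᴴ = E := by
    rw [hE, Matrix.diagonal_conjTranspose]
    congr 1; ext i; simp only [Pi.star_apply]; split_ifs <;> simp
  have hP : Pᴴ = P := by
    simp only [hPdef, conjTranspose_mul, conjTranspose_conjTranspose, hEH, Matrix.mul_assoc]
  have hPP : P * P = P := by
    calc P * P = U * E * (Uᴴ * U) * E * Uᴴ := by simp only [hPdef, Matrix.mul_assoc]
      _ = P := by rw [hU', Matrix.mul_one, Matrix.mul_assoc U, hEE]
  have hAH : Aᴴ = A := by
    have := hρ.eq
    simp [hA, this]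
  have hBH : Bᴴ = B := by
    have := hσ.eq
    simp [hB, this]
  have ht0 := ht.1.le
  have ht1 : 0 ≤ 1 - t := by linarith [ht.2]
  have core := hinge_core (Real.sqrt t) (Real.sqrt (1 - t)) P A B hP hPP hAH hBH
  rw [← Real.sqrt_mul ht0, Real.sq_sqrt ht0, Real.sq_sqrt ht1] at core
  have eq1 : (t : ℂ) • A + ((1 - t : ℝ) : ℂ) • B
      - (Complex.I * ((Real.sqrt (t * (1 - t)) : ℝ) : ℂ)) • (A * B - B * A)
      = (a : ℂ) • (1 : Matrix (Fin n) (Fin n) ℂ) - pswap t ρ σ := by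
    have : A * B - B * A = ρ * σ - σ * ρ := by
      simp only [hA, hB, Matrix.sub_mul, Matrix.mul_sub, Matrix.smul_mul, Matrix.mul_smul,
        Matrix.one_mul, Matrix.mul_one]
      module
    rw [this, hA, hB, pswap]
    push_cast
    module
  rw [eq1, eC] at core
  have eq2 : (P * (U * diagonal (fun i => ((a - hC.eigenvalues i : ℝ) : ℂ)) * Uᴴ)).trace.re
      = ∑ i, max (a - hC.eigenvalues i) 0 := by
    have : P * (U * diagonal (fun i => ((a - hC.eigenvalues i : ℝ) : ℂ)) * Uᴴ)
        = U * E * (Uᴴ * U) * diagonal (fun i => ((a - hC.eigenvalues i : ℝ) : ℂ)) * Uᴴ := by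
      simp only [hPdef, Matrix.mul_assoc]
    rw [this, hU', Matrix.mul_one, Matrix.mul_assoc U, Matrix.mul_assoc, Matrix.trace_mul_comm,
      Matrix.mul_assoc, hU', Matrix.mul_one, hE, Matrix.diagonal_mul_diagonal,
      Matrix.trace_diagonal, Complex.re_sum]
    refine Finset.sum_congr rfl fun i _ => ?_
    split_ifs with h
    · rw [one_mul, Complex.ofReal_re, max_eq_left (by linarith)]
    · rw [zero_mul, Complex.zero_re, max_eq_right (by linarith)]
  rw [eq2] at core
  have kA := key_mat V P (fun i => a - hρ.eigenvalues i) hV hV' hP hPP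
    (fun i j => by have := hr j i; convert this using 2; ring) A eA
  have kB := key_mat W P (fun i => a - hσ.eigenvalues i) hW hW' hP hPP
    (fun i j => by have := hs j i; convert this using 2; ring) B eB
  exact core.trans (add_le_add (mul_le_mul_of_nonneg_left kA ht0)
    (mul_le_mul_of_nonneg_left kB ht1))

lemma trace_sq_eig {n : ℕ} {A : Matrix (Fin n) (Fin n) ℂ} (hA : A.IsHermitian) :
    (A * A).trace.re = ∑ i, hA.eigenvalues i ^ 2 := by
  obtain ⟨V, hV, hV', eV⟩ := spec_decomp hA
  have : A * A = V * diagonal (fun i => (hA.eigenvalues i : ℂ)) * (Vᴴ * V)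
      * diagonal (fun i => (hA.eigenvalues i : ℂ)) * Vᴴ := by
    conv_lhs => rw [eV]
    simp only [Matrix.mul_assoc]
  rw [this, hV', Matrix.mul_one, Matrix.mul_assoc V, Matrix.mul_assoc, Matrix.trace_mul_comm,
      Matrix.mul_assoc, hV', Matrix.mul_one, Matrix.diagonal_mul_diagonal,
      Matrix.trace_diagonal, Complex.re_sum]
  refine Finset.sum_congr rfl fun i _ => ?_
  simp [sq]

lemma trace_eig {n : ℕ} {A : Matrix (Fin n) (Fin n) ℂ} (hA : A.IsHermitian)
    (h1 : A.trace = 1) : ∑ i, hA.eigenvalues i = 1 := by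
  have := hA.trace_eq_sum_eigenvalues
  rw [h1] at this
  have := congrArg Complex.re this
  simpa [Complex.re_sum] using this.symm

lemma psd_zero {n : ℕ} {R : Matrix (Fin n) (Fin n) ℂ} (hR : R.PosSemidef) (i j : Fin n)
    (h : R j j = 0) : R i j = 0 := by
  have := (hR.submatrix ![i, j]).det_nonneg
  rw [Matrix.det_fin_two] at this
  have hc : R j i = star (R i j) := by
    conv_lhs => rw [← hR.isHermitian.eq]
    rfl
  simp [h, hc] at this
  have h2 := (Complex.le_def.1 this).1
  simp at h2
  have h3 : Complex.normSq (R i j) = 0 := by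
    apply le_antisymm _ (Complex.normSq_nonneg _)
    rw [Complex.normSq_apply]
    linarith
  exact Complex.normSq_eq_zero.1 h3

lemma gap {n : ℕ} {ρ σ : Matrix (Fin n) (Fin n) ℂ} (hρ : ρ.PosSemidef) (hσ : σ.PosSemidef)
    (hs1 : ∀ i, hσ.isHermitian.eigenvalues i ≤ 1)
    (X : Matrix (Fin n) (Fin n) ℂ) (hX : X = ρ - σ)
    (hg : ((X * X).trace - 2 * (X * X * σ * σ).trace + 2 * (X * σ * X * σ).trace).re ≤ 0) :
    ρ = σ := by
  obtain ⟨V, hV, hV', eV⟩ := spec_decomp hσ.isHermitian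
  set s := hσ.isHermitian.eigenvalues with hs
  have hs0 : ∀ i, 0 ≤ s i := hσ.eigenvalues_nonneg
  set D : Matrix (Fin n) (Fin n) ℂ := diagonal (fun i => (s i : ℂ)) with hD
  set Y := Vᴴ * X * V with hY
  have hXY : X = V * Y * Vᴴ := by
    calc X = (V * Vᴴ) * X * (V * Vᴴ) := by rw [hV, Matrix.one_mul, Matrix.mul_one]
      _ = V * Y * Vᴴ := by simp only [hY, Matrix.mul_assoc]
  have hR : (Vᴴ * ρ * V).PosSemidef := hρ.conjTranspose_mul_mul_same V
  have hYR : Y = Vᴴ * ρ * V - D := by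
    have : Vᴴ * σ * V = D := by
      calc Vᴴ * σ * V = Vᴴ * (V * D * Vᴴ) * V := by rw [← eV]
        _ = (Vᴴ * V) * D * (Vᴴ * V) := by simp only [Matrix.mul_assoc]
        _ = D := by rw [hV', Matrix.one_mul, Matrix.mul_one]
    rw [hY, hX, Matrix.mul_sub, Matrix.sub_mul, this]
  have canc : ∀ Z : Matrix (Fin n) (Fin n) ℂ, Vᴴ * (V * Z) = Z := fun Z => by
    rw [← Matrix.mul_assoc, hV', Matrix.one_mul]
  have tr : ∀ Z : Matrix (Fin n) (Fin n) ℂ, (V * (Z * Vᴴ)).trace = Z.trace := fun Z => by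
    rw [Matrix.trace_mul_comm, Matrix.mul_assoc, hV', Matrix.mul_one]
  have t1 : (X * X).trace = (Y * Y).trace := by
    rw [hXY, ← tr (Y * Y)]
    simp only [Matrix.mul_assoc, canc]
  have t2 : (X * X * σ * σ).trace = (Y * Y * D * D).trace := by
    rw [hXY, eV, ← tr (Y * Y * D * D)]
    simp only [Matrix.mul_assoc, canc]
  have t3 : (X * σ * X * σ).trace = (Y * D * Y * D).trace := by
    rw [hXY, eV, ← tr (Y * D * Y * D)]
    simp only [Matrix.mul_assoc, canc]
  have hconj : ∀ i j, Y j i = star (Y i j) := by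
    intro i j
    have : Yᴴ = Y := by
      have h1 := hρ.isHermitian.eq
      have h2 := hσ.isHermitian.eq
      simp only [hY, hX, conjTranspose_mul, conjTranspose_sub, conjTranspose_conjTranspose, h1, h2,
        Matrix.mul_assoc]
    conv_lhs => rw [← this]
    rfl
  have u1 : (Y * Y).trace.re = ∑ i, ∑ j, Complex.normSq (Y i j) := by
    simp only [Matrix.trace, Matrix.diag, Matrix.mul_apply, Complex.re_sum]
    refine Finset.sum_congr rfl fun i _ => Finset.sum_congr rfl fun j _ => ?_
    rw [hconj i j]; simp [Complex.normSq_apply]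
  have u2 : (Y * Y * D * D).trace.re = ∑ i, ∑ j, Complex.normSq (Y i j) * s i ^ 2 := by
    simp only [Matrix.trace, Matrix.diag, hD, Matrix.mul_diagonal]
    simp only [Matrix.mul_apply, Complex.re_sum, Finset.sum_mul]
    refine Finset.sum_congr rfl fun i _ => Finset.sum_congr rfl fun j _ => ?_
    rw [hconj i j]; simp [Complex.normSq_apply]; ring
  have u2' : ∑ i, ∑ j, Complex.normSq (Y i j) * s i ^ 2
      = ∑ i, ∑ j, Complex.normSq (Y i j) * s j ^ 2 := by
    rw [Finset.sum_comm]
    refine Finset.sum_congr rfl fun i _ => Finset.sum_congr rfl fun j _ => ?_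
    rw [hconj i j]
    congr 1
    exact Complex.normSq_conj _
  have u3 : (Y * D * Y * D).trace.re = ∑ i, ∑ j, Complex.normSq (Y i j) * (s i * s j) := by
    simp only [Matrix.trace, Matrix.diag, Complex.re_sum]
    refine Finset.sum_congr rfl fun i _ => ?_
    rw [hD, Matrix.mul_diagonal, Matrix.mul_apply, Finset.sum_mul, Complex.re_sum]
    refine Finset.sum_congr rfl fun j _ => ?_
    rw [Matrix.mul_diagonal, hconj i j]
    simp [Complex.normSq_apply]
    ring
  have tot : ∑ i, ∑ j, Complex.normSq (Y i j) * (1 - (s i - s j) ^ 2) ≤ 0 := by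
    refine le_trans (le_of_eq ?_) hg
    rw [t1, t2, t3]
    simp only [Complex.add_re, Complex.sub_re, Complex.mul_re, Complex.re_ofNat, Complex.im_ofNat,
      zero_mul, sub_zero]
    rw [u1, u2, u3, two_mul (∑ i, ∑ j, Complex.normSq (Y i j) * s i ^ 2)]
    nth_rewrite 2 [u2']
    simp only [← Finset.sum_add_distrib, ← Finset.sum_sub_distrib, Finset.mul_sum]
    refine Finset.sum_congr rfl fun i _ => Finset.sum_congr rfl fun j _ => ?_
    ring
  have hnn : ∀ i j, 0 ≤ Complex.normSq (Y i j) * (1 - (s i - s j) ^ 2) := by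
    intro i j
    apply mul_nonneg (Complex.normSq_nonneg _)
    have := hs0 i; have := hs0 j; have := hs1 i; have := hs1 j
    nlinarith
  have hz : ∀ i j, Complex.normSq (Y i j) * (1 - (s i - s j) ^ 2) = 0 := by
    intro i j
    have h0 := le_antisymm tot (Finset.sum_nonneg fun i _ => Finset.sum_nonneg fun j _ => hnn i j)
    have h1 := (Finset.sum_eq_zero_iff_of_nonneg
      (fun i _ => Finset.sum_nonneg fun j _ => hnn i j)).1 h0 i (Finset.mem_univ _)
    exact (Finset.sum_eq_zero_iff_of_nonneg (fun j _ => hnn i j)).1 h1 j (Finset.mem_univ _)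
  have hdiag : ∀ i, Y i i = 0 := by
    intro i
    have := hz i i
    simpa using this
  have col : ∀ i j, i ≠ j → s j = 0 → Y i j = 0 := by
    intro i j hij hsj
    have h1 := hdiag j
    rw [hYR] at h1 ⊢
    have h2 : (Vᴴ * ρ * V) j j = 0 := by
      simpa [hD, hsj] using h1
    have h3 := psd_zero hR i j h2
    simp [hD, hij, h3]
  have hY0 : Y = 0 := by
    ext i j
    rw [Matrix.zero_apply]
    rcases eq_or_ne i j with rfl | hij
    · exact hdiag i
    rcases mul_eq_zero.1 (hz i j) with h | h
    · exact Complex.normSq_eq_zero.1 h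
    · have a1 := hs0 i; have a2 := hs0 j; have a3 := hs1 i; have a4 := hs1 j
      have h5 : (1 - (s i - s j)) * (1 + (s i - s j)) = 0 := by linarith
      rcases mul_eq_zero.1 h5 with h | h
      · exact col i j hij (by linarith)
      · rw [hconj j i, col j i hij.symm (by linarith), star_zero]
  rw [hY0, Matrix.mul_zero, Matrix.zero_mul, hX] at hXY
  exact sub_eq_zero.1 hXY

lemma sq_identity {n : ℕ} (t : ℝ) (ht : t ∈ Set.Ioo (0 : ℝ) 1)
    (ρ σ : Matrix (Fin n) (Fin n) ℂ) (X : Matrix (Fin n) (Fin n) ℂ) (hX : X = ρ - σ) :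
    (pswap t ρ σ * pswap t ρ σ).trace = (t : ℂ) * (ρ * ρ).trace + ((1 - t : ℝ) : ℂ) * (σ * σ).trace
      - ((t * (1 - t) : ℝ) : ℂ) *
        ((X * X).trace - 2 * (X * X * σ * σ).trace + 2 * (X * σ * X * σ).trace) := by
  have hq : ((Real.sqrt (t * (1 - t)) : ℝ) : ℂ) ^ 2 = (t : ℂ) * (1 - t) := by
    rw [← Complex.ofReal_pow, Real.sq_sqrt (mul_nonneg ht.1.le (by linarith [ht.2]))]
    push_cast; ring
  have c2 : (σ * ρ).trace = (ρ * σ).trace := Matrix.trace_mul_comm _ _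
  have d1 : (σ * ρ * ρ).trace = (ρ * ρ * σ).trace := by
    rw [Matrix.mul_assoc, Matrix.trace_mul_comm]
  have d2 : (ρ * σ * ρ).trace = (ρ * ρ * σ).trace := by
    rw [Matrix.trace_mul_comm, Matrix.mul_assoc]
  have d3 : (ρ * σ * σ).trace = (σ * σ * ρ).trace := by
    rw [Matrix.mul_assoc, Matrix.trace_mul_comm]
  have d4 : (σ * ρ * σ).trace = (σ * σ * ρ).trace := by
    rw [Matrix.trace_mul_comm, Matrix.mul_assoc]
  have q1 : (σ * ρ * σ * ρ).trace = (ρ * σ * ρ * σ).trace := by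
    rw [Matrix.trace_mul_comm]; simp only [Matrix.mul_assoc]
  have q2 : (σ * ρ * ρ * σ).trace = (ρ * ρ * σ * σ).trace := by
    rw [Matrix.mul_assoc, Matrix.mul_assoc, Matrix.trace_mul_comm]; simp only [Matrix.mul_assoc]
  have q3 : (ρ * σ * σ * ρ).trace = (ρ * ρ * σ * σ).trace := by
    rw [Matrix.trace_mul_comm]; simp only [Matrix.mul_assoc]
  have q4 : (σ * ρ * σ * σ).trace = (ρ * σ * σ * σ).trace := by
    rw [Matrix.mul_assoc, Matrix.mul_assoc, Matrix.trace_mul_comm]; simp only [Matrix.mul_assoc]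
  have q5 : (σ * σ * ρ * σ).trace = (ρ * σ * σ * σ).trace := by
    rw [Matrix.mul_assoc, Matrix.trace_mul_comm]; simp only [Matrix.mul_assoc]
  have q6 : (σ * σ * σ * ρ).trace = (ρ * σ * σ * σ).trace := by
    rw [Matrix.trace_mul_comm]; simp only [Matrix.mul_assoc]
  rw [hX, pswap]
  simp only [Matrix.mul_add, Matrix.mul_sub, Matrix.add_mul, Matrix.sub_mul, Matrix.mul_smul,
      Matrix.smul_mul, Matrix.trace_add, Matrix.trace_sub, Matrix.trace_smul, smul_eq_mul, smul_sub,
      ← Matrix.mul_assoc, c2, d1, d2, d3, d4, q1, q2, q3, q4, q5, q6]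
  push_cast
  set q : ℂ := ((Real.sqrt (t * (1 - t)) : ℝ) : ℂ)
  have hI := Complex.I_sq
  linear_combination (q ^ 2 * (2 * (ρ * σ * ρ * σ).trace - 2 * (ρ * ρ * σ * σ).trace)) * hI
    - (2 * (ρ * σ * ρ * σ).trace - 2 * (ρ * ρ * σ * σ).trace) * hq

theorem stmt_12 {n : ℕ} (t : ℝ) (ht : t ∈ Set.Ioo (0 : ℝ) 1)
    (ρ σ : Matrix (Fin n) (Fin n) ℂ)
    (hρ : ρ.PosSemidef) (hσ : σ.PosSemidef)
    (hρ1 : ρ.trace = 1) (hσ1 : σ.trace = 1)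
    (hC : (pswap t ρ σ).IsHermitian) :
    vnEntropy hC = t * vnEntropy hρ.isHermitian + (1 - t) * vnEntropy hσ.isHermitian
      ↔ ρ = σ := by
  constructor
  · intro heq
    have sr := trace_eig hρ.isHermitian hρ1
    have ss := trace_eig hσ.isHermitian hσ1
    have hC1 : (pswap t ρ σ).trace = 1 := by
      simp only [pswap, Matrix.trace_add, Matrix.trace_sub, Matrix.trace_smul, hρ1, hσ1,
        Matrix.trace_mul_comm σ ρ]
      simp
    have sc := trace_eig hC hC1
    have r0 := hρ.eigenvalues_nonneg
    have s0 := hσ.eigenvalues_nonneg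
    have r1 : ∀ i, hρ.isHermitian.eigenvalues i ≤ 1 := fun i => by
      rw [← sr]; exact Finset.single_le_sum (fun j _ => r0 j) (Finset.mem_univ i)
    have s1 : ∀ i, hσ.isHermitian.eigenvalues i ≤ 1 := fun i => by
      rw [← ss]; exact Finset.single_le_sum (fun j _ => s0 j) (Finset.mem_univ i)
    have hin := hinge_ineq t ht ρ σ hρ.isHermitian hσ.isHermitian hC
      (fun i j => abs_le.2 ⟨by linarith [r0 i, r1 j], by linarith [r1 i, r0 j]⟩)
      (fun i j => abs_le.2 ⟨by linarith [s0 i, s1 j], by linarith [s1 i, s0 j]⟩)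
    have hsq := sq_identity t ht ρ σ _ rfl
    have hsq' := congrArg Complex.re hsq
    simp only [Complex.sub_re, Complex.add_re, Complex.re_ofReal_mul] at hsq'
    rw [trace_sq_eig hC, trace_sq_eig hρ.isHermitian, trace_sq_eig hσ.isHermitian] at hsq'
    refine gap hρ hσ s1 _ rfl ?_
    simp only [Complex.sub_re, Complex.add_re]
    set r := hρ.isHermitian.eigenvalues with hr
    set s := hσ.isHermitian.eigenvalues with hs
    set c := hC.eigenvalues with hc
    have c0 : ∀ i, 0 ≤ c i := by
      intro i
      have h := hin 0
      have e1 : ∑ i, max (0 - r i) 0 = 0 :=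
        Finset.sum_eq_zero fun i _ => max_eq_right (by linarith [r0 i])
      have e2 : ∑ i, max (0 - s i) 0 = 0 :=
        Finset.sum_eq_zero fun i _ => max_eq_right (by linarith [s0 i])
      rw [e1, e2, mul_zero, mul_zero, add_zero] at h
      have h2 := Finset.single_le_sum (f := fun i => max (0 - c i) 0)
        (fun j _ => le_max_right _ _) (Finset.mem_univ i)
      have h3 := le_max_left (0 - c i) 0
      linarith
    have c1 : ∀ i, c i ≤ 1 := fun i => by
      rw [← sc]; exact Finset.single_le_sum (fun j _ => c0 j) (Finset.mem_univ i)
    have hint : ∀ f : Fin n → ℝ, (∀ i, 0 ≤ f i) → (∀ i, f i ≤ 1) →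
        IntervalIntegrable (fun a : ℝ => ∑ i, max (a - f i) 0 * (a⁻¹ - 1))
          MeasureTheory.volume 0 1 ∧
        ∫ a in (0:ℝ)..1, ∑ i, max (a - f i) 0 * (a⁻¹ - 1)
          = ∑ i, (f i * Real.log (f i) - f i ^ 2 / 2 + 1 / 2) := by
      intro f f0 f1
      constructor
      · have := IntervalIntegrable.sum Finset.univ
          (fun i _ => (hinge_integral (f i) (f0 i) (f1 i)).1)
        have e : (∑ i, fun a : ℝ => max (a - f i) 0 * (a⁻¹ - 1))
            = fun a : ℝ => ∑ i, max (a - f i) 0 * (a⁻¹ - 1) := by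
          ext a; simp
        rwa [e] at this
      · rw [intervalIntegral.integral_finsetSum
          (fun i _ => (hinge_integral (f i) (f0 i) (f1 i)).1)]
        exact Finset.sum_congr rfl fun i _ => (hinge_integral (f i) (f0 i) (f1 i)).2
    obtain ⟨ir, er⟩ := hint r r0 r1
    obtain ⟨is, es⟩ := hint s s0 s1
    obtain ⟨ic, ec⟩ := hint c c0 c1
    have mono := intervalIntegral.integral_mono_on_of_le_Ioo zero_le_one ic
      ((ir.const_mul t).add (is.const_mul (1 - t))) (by
        intro a ha
        have hw : 0 ≤ a⁻¹ - 1 := by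
          have := (one_le_inv₀ ha.1).2 ha.2.le
          linarith
        have := mul_le_mul_of_nonneg_right (hin a) hw
        simp only [← Finset.sum_mul]
        linarith)
    rw [intervalIntegral.integral_add (ir.const_mul t) (is.const_mul (1 - t)),
      intervalIntegral.integral_const_mul, intervalIntegral.integral_const_mul, er, es, ec] at mono
    simp only [Finset.sum_add_distrib, Finset.sum_sub_distrib, ← Finset.sum_div] at mono
    simp only [vnEntropy, Real.negMulLog, neg_mul, Finset.sum_neg_distrib] at heq
    rw [← hr, ← hs, ← hc] at heq
    have hpos : 0 < t * (1 - t) := mul_pos ht.1 (by linarith [ht.2])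
    by_contra hcon
    rw [not_le] at hcon
    have := mul_pos hpos hcon
    linarith
  · rintro rfl
    have h : pswap t ρ ρ = ρ := by
      simp only [pswap, sub_self, smul_zero, add_zero, ← add_smul]
      simp
    have : ∀ (M : Matrix (Fin n) (Fin n) ℂ) (hM : M.IsHermitian), M = ρ →
        vnEntropy hM = vnEntropy hρ.isHermitian := by
      rintro M hM rfl; rfl
    rw [this _ hC h]
    ring
end
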